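/- Assume r ∈ [0,1] is fixed, α is strictly increasing on (a,b), β ∈ BV_loc((a,b),ℝ), and θ_{1−r}(x) ≠ 0 and θ_r(x) ≠ 0 for all x ∈ (a,b). Let u and v be nontrivial real-valued r-balanced solutions of −d(dy/dα) + y dβ = 0 on (a,b). If there are s < t in (a,b) such that W^+[u,v](s) W^-[u,v](t) < 0 and θ > 0 on (s,t), then u and v are linearly dependent. -/

import Mathlib

open Set Filter Function MeasureTheory Topology

noncomputable section

/-- The open interval `(a,b) ⊆ ℝ` determined by extended-real endpoints `a`, `b`. -/
def EI (a b : EReal) : Set ℝ := {x : ℝ | a < (x : EReal) ∧ (x : EReal) < b}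

/-- The jump `Δ_{df}(x) = f⁺(x) - f⁻(x)` of a real-valued function. -/
def jump (f : ℝ → ℝ) (x : ℝ) : ℝ := rightLim f x - leftLim f x

/-- The jump `Δ_{df}(x) = f⁺(x) - f⁻(x)` of a complex-valued function. -/
def jumpC (f : ℝ → ℂ) (x : ℝ) : ℂ := rightLim f x - leftLim f x

/-- `θ_z(x) = 1 - z² Δ_{dα}(x) Δ_{dβ}(x)`. -/
def theta (α β : ℝ → ℝ) (z x : ℝ) : ℝ := 1 - z ^ 2 * jump α x * jump β x

/-- `ω(x) = 1 - Δ_{dα}(x) Δ_{dβ}(x) / 4`. -/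
def omegaFn (α β : ℝ → ℝ) (x : ℝ) : ℝ := 1 - jump α x * jump β x / 4

/-- A real-valued function is `r`-balanced on `I`: it is of locally bounded variation and
`f(x) = r f⁻(x) + (1-r) f⁺(x)` for all `x ∈ I`. -/
def RBalanced (r : ℝ) (I : Set ℝ) (f : ℝ → ℝ) : Prop :=
  LocallyBoundedVariationOn f I ∧
    ∀ x ∈ I, f x = r * leftLim f x + (1 - r) * rightLim f x

/-- A complex-valued function is `r`-balanced on `I`. -/
def RBalancedC (r : ℂ) (I : Set ℝ) (f : ℝ → ℂ) : Prop :=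
  LocallyBoundedVariationOn f I ∧
    ∀ x ∈ I, f x = r * leftLim f x + (1 - r) * rightLim f x

/-- `ν` coincides on `[c,d]` with the Lebesgue–Stieltjes measure `df` generated by `f`,
determined by `df((x,y]) = f⁺(y) - f⁺(x)`. -/
def SMRepresents (ν : SignedMeasure ℝ) (f : ℝ → ℝ) (c d : ℝ) : Prop :=
  ∀ x ∈ Icc c d, ∀ y ∈ Icc c d, x ≤ y → ν (Ioc x y) = rightLim f y - rightLim f x

/-- The integral of `h` against the signed measure `ν` over the set `E`. -/
def sInt (ν : SignedMeasure ℝ) (h : ℝ → ℝ) (E : Set ℝ) : ℝ :=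
  (∫ x in E, h x ∂ν.toJordanDecomposition.posPart) -
    (∫ x in E, h x ∂ν.toJordanDecomposition.negPart)

/-- The equality of (locally finite, real Borel) measures `dg = ∑ j, (h j) d(β j)` on the
interval `I`, expressed via localizations to compact subintervals of `I`. -/
def MeasureEqOn (I : Set ℝ) {ι : Type} [Fintype ι] (g : ℝ → ℝ) (h β : ι → ℝ → ℝ) : Prop :=
  ∀ c ∈ I, ∀ d ∈ I, c < d →
    ∃ (νg : SignedMeasure ℝ) (ν : ι → SignedMeasure ℝ),
      SMRepresents νg g c d ∧ (∀ j, SMRepresents (ν j) (β j) c d) ∧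
      ∀ E : Set ℝ, E ⊆ Ioc c d → MeasurableSet E → νg E = ∑ j, sInt (ν j) (h j) E

/-- The equality of complex measures `dg = ∑ j, (h j) d(β j)` on `I`, encoded via real and
imaginary parts. -/
def MeasureEqOnC (I : Set ℝ) {ι : Type} [Fintype ι] (g : ℝ → ℂ) (h β : ι → ℝ → ℂ) : Prop :=
  MeasureEqOn I (fun x => (g x).re)
    (Sum.elim (fun j x => (h j x).re) (fun j x => -(h j x).im))
    (Sum.elim (fun j x => (β j x).re) (fun j x => (β j x).im)) ∧
  MeasureEqOn I (fun x => (g x).im)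
    (Sum.elim (fun j x => (h j x).im) (fun j x => (h j x).re))
    (Sum.elim (fun j x => (β j x).re) (fun j x => (β j x).im))

/-- The support of `dα` is all of `I`: no open subinterval of `I` is `dα`-null, i.e. on no
open subinterval of `I` do all one-sided limits of `α` coincide with a single constant. -/
def SuppFull (I : Set ℝ) (α : ℝ → ℂ) : Prop :=
  ∀ x ∈ I, ∀ ε > (0 : ℝ), Icc (x - ε) (x + ε) ⊆ I →
    ¬ (∀ p ∈ Ioo (x - ε) (x + ε), ∀ q ∈ Ioo (x - ε) (x + ε),
        rightLim α p = rightLim α q ∧ leftLim α p = rightLim α q)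

/-- `u`, together with the representative `w` of `du/dα`, is an `r`-balanced solution of the
homogeneous equation `-d(du/dα) + u dβ = 0` on `I`: `u` and `w` are `r`-balanced,
`du = w dα` (so `du ≪ dα` with `du/dα = w`), and `dw = u dβ`. -/
def IsHomSol (I : Set ℝ) (r : ℝ) (α β u w : ℝ → ℝ) : Prop :=
  RBalanced r I u ∧ RBalanced r I w ∧
  MeasureEqOn I u (fun _ : Fin 1 => w) (fun _ => α) ∧
  MeasureEqOn I w (fun _ : Fin 1 => u) (fun _ => β)

/-- `u`, together with the representative `w` of `du/dα`, is an `r`-balanced solution of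
`-d(du/dα) + u dβ = dη` on `I` (complex-valued coefficients): `dw = u dβ - dη`. -/
def IsSolC (I : Set ℝ) (r : ℂ) (α β η u w : ℝ → ℂ) : Prop :=
  RBalancedC r I u ∧ RBalancedC r I w ∧
  MeasureEqOnC I u (fun _ : Fin 1 => w) (fun _ => α) ∧
  MeasureEqOnC I w ![u, fun _ => (-1 : ℂ)] ![β, η]

/-- `y` solves the linear system `dy = dφ · y + dψ` on `I`, componentwise:
`d(y i) = ∑ j, (y j) d(φ i j) + dψ i`. -/
def IsSysSolC (I : Set ℝ) (n : ℕ) (φ : ℝ → Matrix (Fin n) (Fin n) ℂ)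
    (ψ : ℝ → Fin n → ℂ) (y : ℝ → Fin n → ℂ) : Prop :=
  ∀ i : Fin n,
    MeasureEqOnC I (fun x => y x i)
      (Sum.elim (fun j : Fin n => fun x => y x j) (fun _ : Unit => fun _ => (1 : ℂ)))
      (Sum.elim (fun j : Fin n => fun x => φ x i j) (fun _ : Unit => fun x => ψ x i))

/-- `Z_I(f) = {x ∈ I : f⁻(x) f⁺(x) ≤ 0}`, the set of sign-changing points of `f` in `I`. -/
def ZSet (f : ℝ → ℝ) (I : Set ℝ) : Set ℝ := {x ∈ I | leftLim f x * rightLim f x ≤ 0}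

/-- `u` changes sign at `s ∈ I`. -/
def ChangesSignAt (I : Set ℝ) (u : ℝ → ℝ) (s : ℝ) : Prop :=
  ∃ δ > (0 : ℝ), Ioo (s - δ) (s + δ) ⊆ I ∧
    (((∀ x ∈ Ioo (s - δ) s, leftLim u x < 0) ∧ ∀ x ∈ Ioo s (s + δ), 0 < rightLim u x) ∨
     ((∀ x ∈ Ioo (s - δ) s, 0 < leftLim u x) ∧ ∀ x ∈ Ioo s (s + δ), rightLim u x < 0))

/-- `u` changes sign in `J` (a subinterval of `I`). -/
def ChangesSignIn (I : Set ℝ) (u : ℝ → ℝ) (J : Set ℝ) : Prop :=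
  ∃ s ∈ J, ChangesSignAt I u s

/-- `u` and `v` are linearly dependent on `I`. -/
def LinDepOn (I : Set ℝ) (u v : ℝ → ℝ) : Prop :=
  ∃ c₁ c₂ : ℝ, ¬(c₁ = 0 ∧ c₂ = 0) ∧ ∀ x ∈ I, c₁ * u x + c₂ * v x = 0

/-- The Lebesgue–Stieltjes measure `dg` is nonnegative on (Borel subsets of) `S`, expressed by
nonnegativity on all subintervals of `S` of each of the four kinds. -/
def PosMeasureOn (g : ℝ → ℝ) (S : Set ℝ) : Prop :=
  (∀ x y : ℝ, x ≤ y → Icc x y ⊆ S → 0 ≤ rightLim g y - leftLim g x) ∧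
  (∀ x y : ℝ, x ≤ y → Ico x y ⊆ S → 0 ≤ leftLim g y - leftLim g x) ∧
  (∀ x y : ℝ, x ≤ y → Ioc x y ⊆ S → 0 ≤ rightLim g y - rightLim g x) ∧
  (∀ x y : ℝ, x < y → Ioo x y ⊆ S → 0 ≤ leftLim g y - rightLim g x)

lemma isOpen_EI (a b : EReal) : IsOpen (EI a b) :=
  (isOpen_Ioo (a := a) (b := b)).preimage continuous_coe_real_ereal

lemma ordConnected_EI (a b : EReal) : (EI a b).OrdConnected :=
  ⟨fun _ hx _ hy _ hz => ⟨hx.1.trans_le (EReal.coe_le_coe_iff.2 hz.1),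
    (EReal.coe_le_coe_iff.2 hz.2).trans_lt hy.2⟩⟩

/-- A function of locally bounded variation on an open set has one-sided limits there. -/
lemma tendsto_leftLim_rightLim_of_lbv {I : Set ℝ} (hI : IsOpen I) {f : ℝ → ℝ}
    (hf : LocallyBoundedVariationOn f I) {x : ℝ} (hx : x ∈ I) :
    Tendsto f (𝓝[<] x) (𝓝 (leftLim f x)) ∧ Tendsto f (𝓝[>] x) (𝓝 (rightLim f x)) := by
  obtain ⟨ε, hε, hball⟩ := Metric.isOpen_iff.1 hI x hx
  rw [Real.ball_eq_Ioo] at hball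
  have hp : x - ε / 2 ∈ I := hball ⟨by linarith, by linarith⟩
  have hq : x + ε / 2 ∈ I := hball ⟨by linarith, by linarith⟩
  have hbv := hf _ _ hp hq
  have hn : I ∩ Icc (x - ε / 2) (x + ε / 2) ∈ 𝓝 x :=
    inter_mem (hI.mem_nhds hx) (Icc_mem_nhds (by linarith) (by linarith))
  constructor
  · apply tendsto_leftLim_of_tendsto
    obtain ⟨l, hl⟩ := hbv.exists_tendsto_left x
    refine ⟨l, ?_⟩
    rwa [inter_comm, nhdsWithin_inter_of_mem' (mem_nhdsWithin_of_mem_nhds hn)] at hl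
  · apply tendsto_rightLim_of_tendsto
    obtain ⟨l, hl⟩ := hbv.exists_tendsto_right x
    refine ⟨l, ?_⟩
    rwa [inter_comm, nhdsWithin_inter_of_mem' (mem_nhdsWithin_of_mem_nhds hn)] at hl

lemma tendsto_rightLim_nhdsLT {f : ℝ → ℝ} {x L : ℝ} (h : Tendsto f (𝓝[<] x) (𝓝 L)) :
    Tendsto (rightLim f) (𝓝[<] x) (𝓝 L) := by
  apply (closed_nhds_basis L).tendsto_right_iff.2
  rintro s ⟨hs, hc⟩
  obtain ⟨u, hu, hus⟩ := (mem_nhdsLT_iff_exists_Ioo_subset).1 (h hs)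
  filter_upwards [Ioo_mem_nhdsLT hu] with c hc'
  apply hc.mem_of_mapClusterPt (mapClusterPt_rightLim f c)
  filter_upwards [mem_nhdsWithin_of_mem_nhds (Ioo_mem_nhds hc'.1 hc'.2)] with y hy using hus hy

lemma tendsto_leftLim_nhdsLT {f : ℝ → ℝ} {x L : ℝ} (h : Tendsto f (𝓝[<] x) (𝓝 L)) :
    Tendsto (leftLim f) (𝓝[<] x) (𝓝 L) := by
  apply (closed_nhds_basis L).tendsto_right_iff.2
  rintro s ⟨hs, hc⟩
  obtain ⟨u, hu, hus⟩ := (mem_nhdsLT_iff_exists_Ioo_subset).1 (h hs)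
  filter_upwards [Ioo_mem_nhdsLT hu] with c hc'
  apply hc.mem_of_mapClusterPt (mapClusterPt_leftLim f c)
  filter_upwards [mem_nhdsWithin_of_mem_nhds (Ioo_mem_nhds hc'.1 hc'.2)] with y hy using hus hy

lemma tendsto_leftLim_nhdsGT {f : ℝ → ℝ} {x L : ℝ} (h : Tendsto f (𝓝[>] x) (𝓝 L)) :
    Tendsto (leftLim f) (𝓝[>] x) (𝓝 L) := by
  apply (closed_nhds_basis L).tendsto_right_iff.2
  rintro s ⟨hs, hc⟩
  obtain ⟨u, hu, hus⟩ := (mem_nhdsGT_iff_exists_Ioo_subset).1 (h hs)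
  filter_upwards [Ioo_mem_nhdsGT hu] with c hc'
  apply hc.mem_of_mapClusterPt (mapClusterPt_leftLim f c)
  filter_upwards [mem_nhdsWithin_of_mem_nhds (Ioo_mem_nhds hc'.1 hc'.2)] with y hy using hus hy

/-- A left-continuous function with right limits that passes from positive to negative values has
a sign-changing point. -/
lemma exists_sign_change_of_pos {F R : ℝ → ℝ} {s t : ℝ} (hst : s < t)
    (hL : ∀ x ∈ Ioc s t, Tendsto F (𝓝[<] x) (𝓝 (F x)))
    (hR : ∀ x ∈ Ico s t, Tendsto F (𝓝[>] x) (𝓝 (R x)))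
    (h0 : 0 < R s) (h1 : F t < 0) : ∃ x ∈ Ioo s t, R x ≤ 0 ∧ 0 ≤ F x := by
  set S := {x ∈ Ioo s t | 0 < F x} with hS
  obtain ⟨p, hp, hpS⟩ := (mem_nhdsGT_iff_exists_Ioo_subset).1
    ((hR s ⟨le_rfl, hst⟩).eventually (lt_mem_nhds h0))
  obtain ⟨q, hq, hqS⟩ := (mem_nhdsLT_iff_exists_Ioo_subset).1
    ((hL t ⟨hst, le_rfl⟩).eventually (gt_mem_nhds h1))
  have hp' : s < p := hp
  have hq' : q < t := hq
  have hbdd : BddAbove S := ⟨t, fun x hx => hx.1.2.le⟩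
  obtain ⟨y, hy1, hy2⟩ := exists_between (lt_min hp' hst)
  have hyS : y ∈ S := ⟨⟨hy1, hy2.trans_le (min_le_right _ _)⟩,
    hpS ⟨hy1, hy2.trans_le (min_le_left _ _)⟩⟩
  have hlt : sSup S < t := by
    refine (csSup_le ⟨y, hyS⟩ fun x hx => ?_).trans_lt (max_lt hst hq')
    by_contra! hcon
    have h2 : F x < 0 := hqS ⟨(le_max_right s q).trans_lt hcon, hx.1.2⟩
    exact absurd hx.2 h2.not_gt
  have hgt : s < sSup S := hy1.trans_le (le_csSup hbdd hyS)
  refine ⟨sSup S, ⟨hgt, hlt⟩, ?_, ?_⟩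
  · by_contra! hcon
    obtain ⟨z, hz, hzS⟩ := (mem_nhdsGT_iff_exists_Ioo_subset).1
      ((hR _ ⟨hgt.le, hlt⟩).eventually (lt_mem_nhds hcon))
    obtain ⟨w, hw1, hw2⟩ := exists_between (lt_min (show sSup S < z from hz) hlt)
    have hwS : w ∈ S := ⟨⟨hgt.trans hw1, hw2.trans_le (min_le_right _ _)⟩,
      hzS ⟨hw1, hw2.trans_le (min_le_left _ _)⟩⟩
    exact absurd (le_csSup hbdd hwS) hw1.not_ge
  · by_contra! hcon
    obtain ⟨z, hz, hzS⟩ := (mem_nhdsLT_iff_exists_Ioo_subset).1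
      ((hL _ ⟨hgt, hlt.le⟩).eventually (gt_mem_nhds hcon))
    obtain ⟨w, hwS, hw⟩ := exists_lt_of_lt_csSup ⟨y, hyS⟩ (show z < sSup S from hz)
    rcases (le_csSup hbdd hwS).lt_or_eq with h | h
    · have h2 : F w < 0 := hzS ⟨hw, h⟩
      exact absurd hwS.2 h2.not_gt
    · have h3 := hwS.2
      rw [h] at h3
      exact absurd h3 hcon.not_gt

lemma exists_sign_change {F R : ℝ → ℝ} {s t : ℝ} (hst : s < t)
    (hL : ∀ x ∈ Ioc s t, Tendsto F (𝓝[<] x) (𝓝 (F x)))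
    (hR : ∀ x ∈ Ico s t, Tendsto F (𝓝[>] x) (𝓝 (R x)))
    (h : R s * F t < 0) : ∃ x ∈ Ioo s t, R x * F x ≤ 0 := by
  rcases mul_neg_iff.1 h with ⟨h0, h1⟩ | ⟨h0, h1⟩
  · obtain ⟨x, hx, h2, h3⟩ := exists_sign_change_of_pos hst hL hR h0 h1
    exact ⟨x, hx, mul_nonpos_of_nonpos_of_nonneg h2 h3⟩
  · obtain ⟨x, hx, h2, h3⟩ := exists_sign_change_of_pos (F := fun x => -F x) (R := fun x => -R x)
      hst (fun x hx => (hL x hx).neg) (fun x hx => (hR x hx).neg) (by linarith) (by linarith)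
    exact ⟨x, hx, mul_nonpos_of_nonneg_of_nonpos (by linarith) (by linarith)⟩

lemma integrableOn_Icc_of_lbv {I : Set ℝ} (hIc : I.OrdConnected) {h : ℝ → ℝ}
    (hh : LocallyBoundedVariationOn h I) {c d : ℝ} (hc : c ∈ I) (hd : d ∈ I)
    (μ : Measure ℝ) [IsFiniteMeasure μ] : IntegrableOn h (Icc c d) μ := by
  obtain ⟨p, q, hp, hq, rfl⟩ := hh.exists_monotoneOn_sub_monotoneOn
  exact ((hp.mono (hIc.out hc hd)).integrableOn_isCompact isCompact_Icc).sub
    ((hq.mono (hIc.out hc hd)).integrableOn_isCompact isCompact_Icc)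

lemma exists_abs_le_of_lbv {I : Set ℝ} (hIc : I.OrdConnected) {h : ℝ → ℝ}
    (hh : LocallyBoundedVariationOn h I) {c d : ℝ} (hc : c ∈ I) (hd : d ∈ I) :
    ∃ K, ∀ x ∈ Icc c d, |h x| ≤ K := by
  obtain ⟨p, q, hp, hq, rfl⟩ := hh.exists_monotoneOn_sub_monotoneOn
  refine ⟨|p c| + |p d| + |q c| + |q d|, fun x hx => ?_⟩
  have hxI := hIc.out hc hd hx
  have h1 := hp hc hxI hx.1
  have h2 := hp hxI hd hx.2
  have h3 := hq hc hxI hx.1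
  have h4 := hq hxI hd hx.2
  have := abs_nonneg (p c)
  have := abs_nonneg (q c)
  have := abs_nonneg (p d)
  have := abs_nonneg (q d)
  rw [Pi.sub_apply, abs_le]
  constructor <;>
  linarith [neg_abs_le (p c), le_abs_self (p d), neg_abs_le (q c), le_abs_self (q d)]

lemma signedMeasure_apply_eq_sub (ν : SignedMeasure ℝ) {E : Set ℝ} (hE : MeasurableSet E) :
    ν E = ν.toJordanDecomposition.posPart.real E - ν.toJordanDecomposition.negPart.real E := by
  conv_lhs => rw [← ν.toSignedMeasure_toJordanDecomposition]
  simp [JordanDecomposition.toSignedMeasure,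
    Measure.toSignedMeasure_apply_measurable hE]

/-- `sInt` over subsets of `(c,d]` depends only on the values of the signed measure on
half-open subintervals of `[c,d]`. -/
lemma sInt_eq_of_represents {ν ν' : SignedMeasure ℝ} {f h : ℝ → ℝ} {c d : ℝ}
    (hν : SMRepresents ν f c d) (hν' : SMRepresents ν' f c d)
    (hint : ∀ (μ : Measure ℝ) [IsFiniteMeasure μ], IntegrableOn h (Icc c d) μ)
    {E : Set ℝ} (hE : E ⊆ Ioc c d) (hEm : MeasurableSet E) : sInt ν h E = sInt ν' h E := by
  set p := ν.toJordanDecomposition.posPart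
  set n := ν.toJordanDecomposition.negPart
  set p' := ν'.toJordanDecomposition.posPart
  set n' := ν'.toJordanDecomposition.negPart
  have key : ∀ x y, (p + n').real (Ioc x y ∩ Ioc c d) = (p' + n).real (Ioc x y ∩ Ioc c d) := by
    intro x y
    rw [Ioc_inter_Ioc]
    rcases le_total (x ⊔ c) (y ⊓ d) with hle | hle
    · have hx : x ⊔ c ∈ Icc c d := ⟨le_sup_right, hle.trans inf_le_right⟩
      have hy : y ⊓ d ∈ Icc c d := ⟨le_sup_right.trans hle, inf_le_right⟩
      have h1 := (hν _ hx _ hy hle).trans (hν' _ hx _ hy hle).symm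
      rw [signedMeasure_apply_eq_sub _ measurableSet_Ioc,
        signedMeasure_apply_eq_sub _ measurableSet_Ioc] at h1
      rw [measureReal_add_apply, measureReal_add_apply]
      linarith
    · simp [Ioc_eq_empty_of_le hle]
  have hmeas : (p + n').restrict (Ioc c d) = (p' + n).restrict (Ioc c d) := by
    apply Measure.ext_of_Ioc
    intro x y _
    rw [Measure.restrict_apply measurableSet_Ioc, Measure.restrict_apply measurableSet_Ioc]
    exact (measureReal_eq_measureReal_iff).1 (key x y)
  have hmE : (p + n').restrict E = (p' + n).restrict E := by
    have := congrArg (fun μ => μ.restrict E) hmeas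
    simpa only [Measure.restrict_restrict hEm, inter_eq_left.2 hE] using this
  have hi : ∀ (μ : Measure ℝ) [IsFiniteMeasure μ], Integrable h (μ.restrict E) := fun μ _ =>
    (hint μ).mono_set (hE.trans Ioc_subset_Icc_self)
  have := congrArg (fun μ => ∫ x, h x ∂μ) hmE
  simp only [Measure.restrict_add] at this
  rw [integral_add_measure (hi _) (hi _), integral_add_measure (hi _) (hi _)] at this
  simp only [sInt]
  linarith

lemma sInt_linear_comb {ν : SignedMeasure ℝ} {h k : ℝ → ℝ} {E : Set ℝ} (c₁ c₂ : ℝ)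
    (hh : ∀ (μ : Measure ℝ) [IsFiniteMeasure μ], IntegrableOn h E μ)
    (hk : ∀ (μ : Measure ℝ) [IsFiniteMeasure μ], IntegrableOn k E μ) :
    sInt ν (fun x => c₁ * h x + c₂ * k x) E = c₁ * sInt ν h E + c₂ * sInt ν k E := by
  have : ∀ (μ : Measure ℝ) [IsFiniteMeasure μ], ∫ x in E, (c₁ * h x + c₂ * k x) ∂μ =
      c₁ * ∫ x in E, h x ∂μ + c₂ * ∫ x in E, k x ∂μ := by
    intro μ _
    rw [integral_add ((hh μ).const_mul c₁) ((hk μ).const_mul c₂), integral_const_mul,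
      integral_const_mul]
  rw [sInt, sInt, sInt, this, this]
  ring

lemma abs_sInt_le {ν : SignedMeasure ℝ} {h : ℝ → ℝ} {E : Set ℝ} {C : ℝ}
    (hC : ∀ x ∈ E, |h x| ≤ C) :
    |sInt ν h E| ≤ C * (ν.toJordanDecomposition.posPart.real E +
      ν.toJordanDecomposition.negPart.real E) := by
  have h1 := norm_setIntegral_le_of_norm_le_const (f := h)
    (measure_lt_top ν.toJordanDecomposition.posPart E) hC
  have h2 := norm_setIntegral_le_of_norm_le_const (f := h)
    (measure_lt_top ν.toJordanDecomposition.negPart E) hC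
  rw [Real.norm_eq_abs] at h1 h2
  rw [mul_add]
  exact (abs_sub _ _).trans (add_le_add h1 h2)

lemma sInt_singleton (ν : SignedMeasure ℝ) (h : ℝ → ℝ) (x : ℝ) :
    sInt ν h {x} = h x * ν {x} := by
  rw [signedMeasure_apply_eq_sub ν (measurableSet_singleton x), sInt, integral_singleton,
    integral_singleton]
  simp only [smul_eq_mul]
  ring

/-- The atoms of a Lebesgue–Stieltjes measure are the jumps of the generating function. -/
lemma represents_singleton {ν : SignedMeasure ℝ} {f : ℝ → ℝ} {c d x : ℝ}
    (hν : SMRepresents ν f c d) (hx : x ∈ Ioc c d)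
    (hf : Tendsto f (𝓝[<] x) (𝓝 (leftLim f x))) : ν {x} = jump f x := by
  obtain ⟨z, hz, hzc, hzx⟩ := exists_seq_strictMono_tendsto' hx.1
  have hset : {x} = ⋂ n, Ioc (z n) x := by
    ext y
    simp only [mem_singleton_iff, mem_iInter, mem_Ioc]
    refine ⟨fun h n => ⟨h ▸ (hzc n).2, h.le⟩, fun h => le_antisymm (h 0).2 ?_⟩
    exact le_of_tendsto' hzx fun n => (h n).1.le
  have hlim : ∀ (μ : Measure ℝ) [IsFiniteMeasure μ],
      Tendsto (fun n => μ.real (Ioc (z n) x)) atTop (𝓝 (μ.real {x})) := by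
    intro μ _
    rw [hset]
    refine (ENNReal.tendsto_toReal (measure_ne_top _ _)).comp
      (tendsto_measure_iInter_atTop (fun n => measurableSet_Ioc.nullMeasurableSet)
        (fun i j hij => Ioc_subset_Ioc_left (hz.monotone hij)) ⟨0, measure_ne_top _ _⟩)
  have h1 : Tendsto (fun n => ν (Ioc (z n) x)) atTop (𝓝 (ν {x})) := by
    simp only [signedMeasure_apply_eq_sub ν measurableSet_Ioc,
      signedMeasure_apply_eq_sub ν (measurableSet_singleton x)]
    exact (hlim _).sub (hlim _)
  have hzx' : Tendsto z atTop (𝓝[<] x) :=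
    tendsto_nhdsWithin_iff.2 ⟨hzx, Eventually.of_forall fun n => (hzc n).2⟩
  have h2 : Tendsto (fun n => ν (Ioc (z n) x)) atTop (𝓝 (jump f x)) := by
    refine (tendsto_const_nhds.sub ((tendsto_rightLim_nhdsLT hf).comp hzx')).congr fun n => ?_
    exact (hν _ ⟨(hzc n).1.le, (hzc n).2.le.trans hx.2⟩ _ ⟨hx.1.le, hx.2⟩ (hzc n).2.le).symm
  exact tendsto_nhds_unique h1 h2

lemma MeasureEqOn.sub_eq_sInt {I : Set ℝ} (hIc : I.OrdConnected) {g h f : ℝ → ℝ}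
    (H : MeasureEqOn I g (fun _ : Fin 1 => h) (fun _ => f))
    (hh : LocallyBoundedVariationOn h I) {c d : ℝ} (hc : c ∈ I) (hd : d ∈ I) (hcd : c < d)
    {ν : SignedMeasure ℝ} (hν : SMRepresents ν f c d) {x y : ℝ} (hx : x ∈ Icc c d)
    (hy : y ∈ Icc c d) (hxy : x ≤ y) :
    rightLim g y - rightLim g x = sInt ν h (Ioc x y) := by
  obtain ⟨νg, ν', hg, hf', heq⟩ := H c hc d hd hcd
  have hsub : Ioc x y ⊆ Ioc c d := Ioc_subset_Ioc hx.1 hy.2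
  rw [← hg x hx y hy hxy, heq _ hsub measurableSet_Ioc, Fin.sum_univ_one]
  exact sInt_eq_of_represents (hf' 0) hν
    (fun μ _ => integrableOn_Icc_of_lbv hIc hh hc hd μ) hsub measurableSet_Ioc

lemma MeasureEqOn.jump_eq {I : Set ℝ} (hI : IsOpen I) {g h f : ℝ → ℝ}
    (H : MeasureEqOn I g (fun _ : Fin 1 => h) (fun _ => f))
    (hg : LocallyBoundedVariationOn g I)
    (hf : LocallyBoundedVariationOn f I) {x : ℝ} (hx : x ∈ I) :
    jump g x = h x * jump f x := by
  obtain ⟨ε, hε, hball⟩ := Metric.isOpen_iff.1 hI x hx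
  rw [Real.ball_eq_Ioo] at hball
  have hc : x - ε / 2 ∈ I := hball ⟨by linarith, by linarith⟩
  obtain ⟨νg, ν, hνg, hν, heq⟩ := H _ hc _ hx (by linarith)
  have hxm : x ∈ Ioc (x - ε / 2) x := ⟨by linarith, le_rfl⟩
  rw [← represents_singleton hνg hxm (tendsto_leftLim_rightLim_of_lbv hI hg hx).1,
    ← represents_singleton (hν 0) hxm (tendsto_leftLim_rightLim_of_lbv hI hf hx).1,
    heq {x} (singleton_subset_iff.2 hxm) (measurableSet_singleton x), Fin.sum_univ_one,
    sInt_singleton]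

/-- Local uniqueness: zero right limits at `z` propagate to the right of `z`. -/
lemma exists_eq_zero_right {y yL yR w wL wR : ℝ → ℝ} {m : Measure ℝ} [IsFiniteMeasure m]
    {r c t K : ℝ} (hr : r ∈ Icc (0 : ℝ) 1)
    (hyL : ∀ x ∈ Ioc c t, Tendsto yR (𝓝[<] x) (𝓝 (yL x)))
    (hwL : ∀ x ∈ Ioc c t, Tendsto wR (𝓝[<] x) (𝓝 (wL x)))
    (hy : ∀ x ∈ Icc c t, y x = r * yL x + (1 - r) * yR x)
    (hw : ∀ x ∈ Icc c t, w x = r * wL x + (1 - r) * wR x)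
    (hK : ∀ x ∈ Icc c t, |y x| ≤ K ∧ |w x| ≤ K)
    (hey : ∀ x ∈ Icc c t, ∀ x' ∈ Icc c t, x < x' → ∀ C, (∀ z ∈ Ioc x x', |w z| ≤ C) →
      |yR x' - yR x| ≤ C * m.real (Ioc x x'))
    (hew : ∀ x ∈ Icc c t, ∀ x' ∈ Icc c t, x < x' → ∀ C, (∀ z ∈ Ioc x x', |y z| ≤ C) →
      |wR x' - wR x| ≤ C * m.real (Ioc x x'))
    {z : ℝ} (hz : z ∈ Ico c t) (hy0 : yR z = 0) (hw0 : wR z = 0) :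
    ∃ d ∈ Ioc z t, ∀ x ∈ Ioc z d, y x = 0 ∧ w x = 0 := by
  have hlim : Tendsto (fun d => m (Ioc z d)) (𝓝[>] z) (𝓝 0) := by
    have := tendsto_measure_biInter_gt (μ := m) (s := fun d => Ioc z d) (a := z)
      (fun _ _ => measurableSet_Ioc.nullMeasurableSet)
      (fun i j _ hij => Ioc_subset_Ioc_right hij) ⟨z + 1, by simp, measure_ne_top _ _⟩
    have hemp : ⋂ d > z, Ioc z d = ∅ := by
      ext x
      simp only [mem_iInter, mem_Ioc, mem_empty_iff_false, iff_false]
      intro hx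
      have h1 := (hx (z + 1) (by simp)).1
      obtain ⟨d, hd1, hd2⟩ := exists_between h1
      exact absurd (hx d hd1).2 hd2.not_ge
    rwa [hemp, measure_empty] at this
  have hlim' : Tendsto (fun d => m.real (Ioc z d)) (𝓝[>] z) (𝓝 0) :=
    (ENNReal.tendsto_toReal ENNReal.zero_ne_top).comp hlim
  obtain ⟨d, hdm, hd⟩ := ((hlim'.eventually (gt_mem_nhds (show (0 : ℝ) < 1 / 2 by norm_num))).and
    (Ioc_mem_nhdsGT hz.2)).exists
  refine ⟨d, hd, ?_⟩
  have hzI : z ∈ Icc c t := ⟨hz.1, hz.2.le⟩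
  have half : ∀ {f fL fR g : ℝ → ℝ},
      (∀ x ∈ Ioc c t, Tendsto fR (𝓝[<] x) (𝓝 (fL x))) →
      (∀ x ∈ Icc c t, f x = r * fL x + (1 - r) * fR x) →
      (∀ x ∈ Icc c t, ∀ x' ∈ Icc c t, x < x' → ∀ C, (∀ z ∈ Ioc x x', |g z| ≤ C) →
        |fR x' - fR x| ≤ C * m.real (Ioc x x')) → fR z = 0 →
      ∀ C, (∀ x ∈ Ioc z d, |g x| ≤ C) → ∀ x ∈ Ioc z d, |f x| ≤ C / 2 := by
    intro f fL fR g hL hf he h0 C hC x hx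
    have hC0 : 0 ≤ C := (abs_nonneg _).trans (hC x hx)
    have hRb : ∀ x ∈ Ioc z d, |fR x| ≤ C / 2 := by
      intro x hx
      have h1 := he z hzI x ⟨hz.1.trans hx.1.le, hx.2.trans hd.2⟩ hx.1 C
        (fun x' hx' => hC x' ⟨hx'.1, hx'.2.trans hx.2⟩)
      rw [h0, sub_zero] at h1
      have h2 : m.real (Ioc z x) ≤ m.real (Ioc z d) := measureReal_mono (Ioc_subset_Ioc_right hx.2)
      have h3 : C * m.real (Ioc z x) ≤ C * (1 / 2) :=
        mul_le_mul_of_nonneg_left (h2.trans hdm.le) hC0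
      linarith
    have hLb : |fL x| ≤ C / 2 := by
      refine le_of_tendsto (hL x ⟨hz.1.trans_lt hx.1, hx.2.trans hd.2⟩).abs ?_
      filter_upwards [Ioo_mem_nhdsLT hx.1] with x' hx'
      exact hRb x' ⟨hx'.1, hx'.2.le.trans hx.2⟩
    rw [hf x ⟨hz.1.trans hx.1.le, hx.2.trans hd.2⟩]
    have hR := hRb x hx
    rw [abs_le] at hLb hR ⊢
    obtain ⟨hr0, hr1⟩ := hr
    constructor <;> nlinarith
  have iter : ∀ n : ℕ, ∀ x ∈ Ioc z d, |y x| ≤ K * (1 / 2) ^ n ∧ |w x| ≤ K * (1 / 2) ^ n := by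
    intro n
    induction n with
    | zero =>
      intro x hx
      simpa using hK x ⟨hz.1.trans hx.1.le, hx.2.trans hd.2⟩
    | succ n ih =>
      intro x hx
      have h1 := half hyL hy hey hy0 _ (fun x hx => (ih x hx).2) x hx
      have h2 := half hwL hw hew hw0 _ (fun x hx => (ih x hx).1) x hx
      rw [pow_succ]
      constructor <;> linarith
  have hgeo : Tendsto (fun n : ℕ => K * (1 / 2 : ℝ) ^ n) atTop (𝓝 0) := by
    simpa using (tendsto_pow_atTop_nhds_zero_of_lt_one (r := (1 / 2 : ℝ)) (by norm_num)
      (by norm_num)).const_mul K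
  intro x hx
  exact ⟨abs_nonpos_iff.1 (ge_of_tendsto' hgeo fun n => (iter n x hx).1),
    abs_nonpos_iff.1 (ge_of_tendsto' hgeo fun n => (iter n x hx).2)⟩

/-- Uniqueness to the right of a zero initial value. -/
lemma eq_zero_of_initial_zero {y yL yR w wL wR : ℝ → ℝ} {m : Measure ℝ} [IsFiniteMeasure m]
    {r c t K : ℝ} (hr : r ∈ Icc (0 : ℝ) 1) (hct : c ≤ t)
    (hyl : ∀ x ∈ Ioc c t, Tendsto y (𝓝[<] x) (𝓝 (yL x)))
    (hwl : ∀ x ∈ Ioc c t, Tendsto w (𝓝[<] x) (𝓝 (wL x)))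
    (hyL : ∀ x ∈ Ioc c t, Tendsto yR (𝓝[<] x) (𝓝 (yL x)))
    (hwL : ∀ x ∈ Ioc c t, Tendsto wR (𝓝[<] x) (𝓝 (wL x)))
    (hy : ∀ x ∈ Icc c t, y x = r * yL x + (1 - r) * yR x)
    (hw : ∀ x ∈ Icc c t, w x = r * wL x + (1 - r) * wR x)
    (hK : ∀ x ∈ Icc c t, |y x| ≤ K ∧ |w x| ≤ K)
    (hey : ∀ x ∈ Icc c t, ∀ x' ∈ Icc c t, x < x' → ∀ C, (∀ z ∈ Ioc x x', |w z| ≤ C) →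
      |yR x' - yR x| ≤ C * m.real (Ioc x x'))
    (hew : ∀ x ∈ Icc c t, ∀ x' ∈ Icc c t, x < x' → ∀ C, (∀ z ∈ Ioc x x', |y z| ≤ C) →
      |wR x' - wR x| ≤ C * m.real (Ioc x x'))
    (hleft : ∀ x ∈ Ioc c t, yL x = 0 → wL x = 0 → y x = 0 ∧ w x = 0)
    (hright : ∀ x ∈ Icc c t, y x = 0 → w x = 0 → yR x = 0 ∧ wR x = 0)
    (h0 : y c = 0 ∧ w c = 0) : ∀ x ∈ Icc c t, y x = 0 ∧ w x = 0 := by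
  set S := {x ∈ Icc c t | ∀ z ∈ Icc c x, y z = 0 ∧ w z = 0} with hS
  have hcS : c ∈ S := ⟨⟨le_rfl, hct⟩, fun z hz => by rwa [le_antisymm hz.2 hz.1]⟩
  have hbdd : BddAbove S := ⟨t, fun x hx => hx.1.2⟩
  have hcs : c ≤ sSup S := le_csSup hbdd hcS
  have hst : sSup S ≤ t := csSup_le ⟨c, hcS⟩ fun x hx => hx.1.2
  have hlt : ∀ z ∈ Ico c (sSup S), y z = 0 ∧ w z = 0 := by
    intro z hz
    obtain ⟨x, hx, hzx⟩ := exists_lt_of_lt_csSup ⟨c, hcS⟩ hz.2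
    exact hx.2 z ⟨hz.1, hzx.le⟩
  have hat : y (sSup S) = 0 ∧ w (sSup S) = 0 := by
    rcases hcs.eq_or_lt with h | h
    · rwa [← h]
    · have hmem : sSup S ∈ Ioc c t := ⟨h, hst⟩
      refine hleft _ hmem ?_ ?_
      · refine tendsto_nhds_unique (hyl _ hmem) (tendsto_const_nhds.congr' ?_)
        filter_upwards [Ioo_mem_nhdsLT h] with x hx using (hlt x ⟨hx.1.le, hx.2⟩).1.symm
      · refine tendsto_nhds_unique (hwl _ hmem) (tendsto_const_nhds.congr' ?_)
        filter_upwards [Ioo_mem_nhdsLT h] with x hx using (hlt x ⟨hx.1.le, hx.2⟩).2.symm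
  have hle : ∀ z ∈ Icc c (sSup S), y z = 0 ∧ w z = 0 := by
    intro z hz
    rcases hz.2.lt_or_eq with h | h
    · exact hlt z ⟨hz.1, h⟩
    · rwa [h]
  rcases hst.lt_or_eq with h | h
  · exfalso
    obtain ⟨hy0, hw0⟩ := hright _ ⟨hcs, hst⟩ hat.1 hat.2
    obtain ⟨d, hd, hd0⟩ := exists_eq_zero_right hr hyL hwL hy hw hK hey hew ⟨hcs, h⟩ hy0 hw0
    have hdS : d ∈ S := by
      refine ⟨⟨hcs.trans hd.1.le, hd.2⟩, fun z hz => ?_⟩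
      rcases le_or_gt z (sSup S) with h' | h'
      · exact hle z ⟨hz.1, h'⟩
      · exact hd0 z ⟨h', hz.2⟩
    exact absurd (le_csSup hbdd hdS) hd.1.not_ge
  · rwa [h] at hle

lemma exists_ne_zero_comb {p q p' q' : ℝ} (h : p * q' - q * p' = 0) :
    ∃ c₁ c₂ : ℝ, ¬(c₁ = 0 ∧ c₂ = 0) ∧ c₁ * p + c₂ * q = 0 ∧ c₁ * p' + c₂ * q' = 0 := by
  by_cases h1 : p = 0 ∧ q = 0
  · by_cases h2 : p' = 0 ∧ q' = 0
    · exact ⟨1, 0, by simp, by simp [h1.1], by simp [h2.1]⟩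
    · exact ⟨q', -p', by rintro ⟨ha, hb⟩; exact h2 ⟨by linarith, ha⟩, by simp [h1.1, h1.2],
        by ring⟩
  · exact ⟨q, -p, by rintro ⟨ha, hb⟩; exact h1 ⟨by linarith, ha⟩, by ring, by linarith⟩

/-- The one-sided limits of a balanced function in terms of its value and its jump. -/
lemma RBalanced.lims_eq {I : Set ℝ} {r : ℝ} {f : ℝ → ℝ} (hf : RBalanced r I f) {x : ℝ}
    (hx : x ∈ I) : rightLim f x = f x + r * jump f x ∧
      leftLim f x = f x - (1 - r) * jump f x := by
  have := hf.2 x hx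
  unfold jump
  constructor <;> linarith

/-- Lemma 5.2: if `W⁺[u,v](s) W⁻[u,v](t) < 0` for some `s < t` in `(a,b)`
and `θ = θ_r/θ_{1-r} > 0` on `(s,t)`, then `u` and `v` are linearly dependent. -/
theorem statement12 (a b : EReal) (hab : a < b) (r : ℝ) (hr : r ∈ Icc (0 : ℝ) 1)
    (α β : ℝ → ℝ) (hα : StrictMonoOn α (EI a b))
    (hβ : LocallyBoundedVariationOn β (EI a b))
    (hθ : ∀ x ∈ EI a b, theta α β (1 - r) x ≠ 0 ∧ theta α β r x ≠ 0)
    (u wu v wv : ℝ → ℝ)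
    (hu : IsHomSol (EI a b) r α β u wu) (hv : IsHomSol (EI a b) r α β v wv)
    (hnu : ¬ ∀ x ∈ EI a b, u x = 0) (hnv : ¬ ∀ x ∈ EI a b, v x = 0)
    (s t : ℝ) (hs : s ∈ EI a b) (ht : t ∈ EI a b) (hst : s < t)
    (hW : rightLim (fun x => u x * wv x - v x * wu x) s *
        leftLim (fun x => u x * wv x - v x * wu x) t < 0)
    (hθpos : ∀ x ∈ Ioo s t, 0 < theta α β r x / theta α β (1 - r) x) :
    LinDepOn (EI a b) u v := by
  have hI := isOpen_EI a b
  have hIc := ordConnected_EI a b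
  have hα' : LocallyBoundedVariationOn α (EI a b) := hα.monotoneOn.locallyBoundedVariationOn
  obtain ⟨bu, bwu, mu, mwu⟩ := hu
  obtain ⟨bv, bwv, mv, mwv⟩ := hv
  have lim := fun {f : ℝ → ℝ} (hf : LocallyBoundedVariationOn f (EI a b)) {x : ℝ}
    (hx : x ∈ EI a b) => tendsto_leftLim_rightLim_of_lbv hI hf hx
  have hsub : Icc s t ⊆ EI a b := hIc.out hs ht
  set W : ℝ → ℝ := fun x => u x * wv x - v x * wu x with hWdef
  have hWl : ∀ x ∈ EI a b, Tendsto W (𝓝[<] x)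
      (𝓝 (leftLim u x * leftLim wv x - leftLim v x * leftLim wu x)) := fun x hx =>
    ((lim bu.1 hx).1.mul (lim bwv.1 hx).1).sub ((lim bv.1 hx).1.mul (lim bwu.1 hx).1)
  have hWr : ∀ x ∈ EI a b, Tendsto W (𝓝[>] x)
      (𝓝 (rightLim u x * rightLim wv x - rightLim v x * rightLim wu x)) := fun x hx =>
    ((lim bu.1 hx).2.mul (lim bwv.1 hx).2).sub ((lim bv.1 hx).2.mul (lim bwu.1 hx).2)
  have ju := fun {x : ℝ} (hx : x ∈ EI a b) => mu.jump_eq hI bu.1 hα' hx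
  have jv := fun {x : ℝ} (hx : x ∈ EI a b) => mv.jump_eq hI bv.1 hα' hx
  have jwu := fun {x : ℝ} (hx : x ∈ EI a b) => mwu.jump_eq hI bwu.1 hβ hx
  have jwv := fun {x : ℝ} (hx : x ∈ EI a b) => mwv.jump_eq hI bwv.1 hβ hx
  have hWl' : ∀ x ∈ EI a b, leftLim W x = theta α β (1 - r) x * W x := by
    intro x hx
    rw [leftLim_eq_of_tendsto (hWl x hx), (bu.lims_eq hx).2, (bv.lims_eq hx).2,
      (bwu.lims_eq hx).2, (bwv.lims_eq hx).2, ju hx, jv hx, jwu hx, jwv hx, theta, hWdef]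
    ring
  have hWr' : ∀ x ∈ EI a b, rightLim W x = theta α β r x * W x := by
    intro x hx
    rw [rightLim_eq_of_tendsto (hWr x hx), (bu.lims_eq hx).1, (bv.lims_eq hx).1,
      (bwu.lims_eq hx).1, (bwv.lims_eq hx).1, ju hx, jv hx, jwu hx, jwv hx, theta, hWdef]
    ring
  obtain ⟨x₀, hx₀, hsign⟩ := exists_sign_change (F := leftLim W) (R := rightLim W) hst
    (fun x hx => tendsto_leftLim_nhdsLT
      (tendsto_leftLim_of_tendsto ⟨_, hWl x (hsub ⟨hx.1.le, hx.2⟩)⟩))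
    (fun x hx => tendsto_leftLim_nhdsGT
      (tendsto_rightLim_of_tendsto ⟨_, hWr x (hsub ⟨hx.1, hx.2.le⟩)⟩)) hW
  have hx₀I : x₀ ∈ EI a b := hsub ⟨hx₀.1.le, hx₀.2.le⟩
  have hW0 : W x₀ = 0 := by
    by_contra hne
    rw [hWl' _ hx₀I, hWr' _ hx₀I] at hsign
    have h1 : 0 < theta α β r x₀ * theta α β (1 - r) x₀ := by
      rcases div_pos_iff.1 (hθpos x₀ hx₀) with ⟨h, h'⟩ | ⟨h, h'⟩
      · exact mul_pos h h'
      · exact mul_pos_of_neg_of_neg h h'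
    have h2 : 0 < W x₀ ^ 2 := by positivity
    nlinarith [mul_pos h1 h2]
  obtain ⟨c₁, c₂, hc, hy0, hw0⟩ := exists_ne_zero_comb (p := u x₀) (q := v x₀) (p' := wu x₀)
    (q' := wv x₀) hW0
  exfalso
  have hsub' : Icc x₀ t ⊆ EI a b := hIc.out hx₀I ht
  have hsubo : Ioc x₀ t ⊆ EI a b := Ioc_subset_Icc_self.trans hsub'
  obtain ⟨-, να, -, hνα, -⟩ := mu x₀ hx₀I t ht hx₀.2
  obtain ⟨-, νβ, -, hνβ, -⟩ := mwu x₀ hx₀I t ht hx₀.2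
  obtain ⟨Ku, hKu⟩ := exists_abs_le_of_lbv hIc bu.1 hx₀I ht
  obtain ⟨Kv, hKv⟩ := exists_abs_le_of_lbv hIc bv.1 hx₀I ht
  obtain ⟨Kwu, hKwu⟩ := exists_abs_le_of_lbv hIc bwu.1 hx₀I ht
  obtain ⟨Kwv, hKwv⟩ := exists_abs_le_of_lbv hIc bwv.1 hx₀I ht
  set A := (να 0).toJordanDecomposition.posPart + (να 0).toJordanDecomposition.negPart
  set B := (νβ 0).toJordanDecomposition.posPart + (νβ 0).toJordanDecomposition.negPart
  have hAB : ∀ E, (A + B).real E = (να 0).toJordanDecomposition.posPart.real E +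
      (να 0).toJordanDecomposition.negPart.real E +
      ((νβ 0).toJordanDecomposition.posPart.real E +
      (νβ 0).toJordanDecomposition.negPart.real E) := by
    intro E
    simp only [A, B]
    rw [measureReal_add_apply, measureReal_add_apply, measureReal_add_apply]
  have hcomb : ∀ {f g : ℝ → ℝ} {k l : ℝ} {x : ℝ}, |f x| ≤ k → |g x| ≤ l →
      |c₁ * f x + c₂ * g x| ≤ |c₁| * k + |c₂| * l := by
    intro f g k l x hf hg
    refine (abs_add_le _ _).trans ?_
    rw [abs_mul, abs_mul]
    gcongr
  have est : ∀ {f₁ f₂ h₁ h₂ γ : ℝ → ℝ} {ν : SignedMeasure ℝ},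
      MeasureEqOn (EI a b) f₁ (fun _ : Fin 1 => h₁) (fun _ => γ) →
      MeasureEqOn (EI a b) f₂ (fun _ : Fin 1 => h₂) (fun _ => γ) →
      LocallyBoundedVariationOn h₁ (EI a b) → LocallyBoundedVariationOn h₂ (EI a b) →
      SMRepresents ν γ x₀ t → (∀ E, ν.toJordanDecomposition.posPart.real E +
        ν.toJordanDecomposition.negPart.real E ≤ (A + B).real E) →
      ∀ x ∈ Icc x₀ t, ∀ x' ∈ Icc x₀ t, x < x' → ∀ C,
      (∀ z ∈ Ioc x x', |c₁ * h₁ z + c₂ * h₂ z| ≤ C) →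
      |(c₁ * rightLim f₁ x' + c₂ * rightLim f₂ x') -
        (c₁ * rightLim f₁ x + c₂ * rightLim f₂ x)| ≤ C * (A + B).real (Ioc x x') := by
    intro f₁ f₂ h₁ h₂ γ ν m₁ m₂ b₁ b₂ hν hle x hx x' hx' hxx' C hC
    have hss : Ioc x x' ⊆ Icc x₀ t := fun z hz => ⟨hx.1.trans hz.1.le, hz.2.trans hx'.2⟩
    have e₁ := m₁.sub_eq_sInt hIc b₁ hx₀I ht hx₀.2 hν hx hx' hxx'.le
    have e₂ := m₂.sub_eq_sInt hIc b₂ hx₀I ht hx₀.2 hν hx hx' hxx'.le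
    have e₃ := sInt_linear_comb (ν := ν) (E := Ioc x x') c₁ c₂
      (fun μ _ => (integrableOn_Icc_of_lbv hIc b₁ hx₀I ht μ).mono_set hss)
      (fun μ _ => (integrableOn_Icc_of_lbv hIc b₂ hx₀I ht μ).mono_set hss)
    have e₄ : (c₁ * rightLim f₁ x' + c₂ * rightLim f₂ x') -
        (c₁ * rightLim f₁ x + c₂ * rightLim f₂ x) =
        sInt ν (fun z => c₁ * h₁ z + c₂ * h₂ z) (Ioc x x') := by
      rw [e₃, ← e₁, ← e₂]
      ring
    rw [e₄]
    exact (abs_sInt_le hC).trans (mul_le_mul_of_nonneg_left (hle _)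
      ((abs_nonneg _).trans (hC x' ⟨hxx', le_rfl⟩)))
  have hzero := eq_zero_of_initial_zero
    (y := fun x => c₁ * u x + c₂ * v x)
    (yL := fun x => c₁ * leftLim u x + c₂ * leftLim v x)
    (yR := fun x => c₁ * rightLim u x + c₂ * rightLim v x)
    (w := fun x => c₁ * wu x + c₂ * wv x)
    (wL := fun x => c₁ * leftLim wu x + c₂ * leftLim wv x)
    (wR := fun x => c₁ * rightLim wu x + c₂ * rightLim wv x)
    (m := A + B) (K := max (|c₁| * Ku + |c₂| * Kv) (|c₁| * Kwu + |c₂| * Kwv)) hr hx₀.2.le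
    (fun x hx => ((lim bu.1 (hsubo hx)).1.const_mul c₁).add
      ((lim bv.1 (hsubo hx)).1.const_mul c₂))
    (fun x hx => ((lim bwu.1 (hsubo hx)).1.const_mul c₁).add
      ((lim bwv.1 (hsubo hx)).1.const_mul c₂))
    (fun x hx => ((tendsto_rightLim_nhdsLT (lim bu.1 (hsubo hx)).1).const_mul c₁).add
      ((tendsto_rightLim_nhdsLT (lim bv.1 (hsubo hx)).1).const_mul c₂))
    (fun x hx => ((tendsto_rightLim_nhdsLT (lim bwu.1 (hsubo hx)).1).const_mul c₁).add
      ((tendsto_rightLim_nhdsLT (lim bwv.1 (hsubo hx)).1).const_mul c₂))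
    (fun x hx => by linear_combination c₁ * bu.2 x (hsub' hx) + c₂ * bv.2 x (hsub' hx))
    (fun x hx => by linear_combination c₁ * bwu.2 x (hsub' hx) + c₂ * bwv.2 x (hsub' hx))
    (fun x hx => ⟨(hcomb (hKu x hx) (hKv x hx)).trans (le_max_left _ _),
      (hcomb (hKwu x hx) (hKwv x hx)).trans (le_max_right _ _)⟩)
    (est mu mv bwu.1 bwv.1 (hνα 0) (fun E => by
      rw [hAB]
      linarith [measureReal_nonneg (μ := (νβ 0).toJordanDecomposition.posPart) (s := E),
        measureReal_nonneg (μ := (νβ 0).toJordanDecomposition.negPart) (s := E)]))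
    (est mwu mwv bu.1 bv.1 (hνβ 0) (fun E => by
      rw [hAB]
      linarith [measureReal_nonneg (μ := (να 0).toJordanDecomposition.posPart) (s := E),
        measureReal_nonneg (μ := (να 0).toJordanDecomposition.negPart) (s := E)]))
    (fun x hx h1 h2 => by
      have hxI := hsubo hx
      have hne := (hθ x hxI).1
      simp only [(bu.lims_eq hxI).2, (bv.lims_eq hxI).2, (bwu.lims_eq hxI).2,
        (bwv.lims_eq hxI).2, ju hxI, jv hxI, jwu hxI, jwv hxI] at h1 h2
      rw [theta] at hne
      constructor
      · refine (mul_eq_zero.1 ?_).resolve_left hne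
        linear_combination h1 + (1 - r) * jump α x * h2
      · refine (mul_eq_zero.1 ?_).resolve_left hne
        linear_combination h2 + (1 - r) * jump β x * h1)
    (fun x hx h1 h2 => by
      have hxI := hsub' hx
      simp only [(bu.lims_eq hxI).1, (bv.lims_eq hxI).1, (bwu.lims_eq hxI).1,
        (bwv.lims_eq hxI).1, ju hxI, jv hxI, jwu hxI, jwv hxI]
      constructor
      · linear_combination h1 + r * jump α x * h2
      · linear_combination h2 + r * jump β x * h1)
    ⟨hy0, hw0⟩
  obtain ⟨h1, h2⟩ := hzero t ⟨hx₀.2.le, le_rfl⟩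
  have hWt : W t = 0 := by
    have e1 : c₁ * W t = 0 := by
      simp only [hWdef]
      linear_combination wv t * h1 - v t * h2
    have e2 : c₂ * W t = 0 := by
      simp only [hWdef]
      linear_combination u t * h2 - wu t * h1
    by_contra hne
    exact hc ⟨(mul_eq_zero.1 e1).resolve_right hne, (mul_eq_zero.1 e2).resolve_right hne⟩
  rw [hWl' t ht, hWt, mul_zero, mul_zero] at hW
  exact lt_irrefl _ hW
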